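/- For all λ, μ ∈ ℂ, the creation operators commute: B_N(λ) B_N(μ) = B_N(μ) B_N(λ) as operators on 𝔥_N. -/

import Mathlib

open Complex Matrix Filter Topology

noncomputable section

/-- The index set of the standard basis of `𝔥_N = (ℂ²)^{⊗N}`. -/
abbrev St (N : ℕ) := Fin N → Fin 2

/-- The Pauli matrices `σ¹, σ², σ³`. -/
def pauli : Fin 3 → Matrix (Fin 2) (Fin 2) ℂ
  | 0 => !![0, 1; 1, 0]
  | 1 => !![0, -Complex.I; Complex.I, 0]
  | 2 => !![1, 0; 0, -1]

/-- The operator `σₖᵃ` on `𝔥_N`, acting as `σᵃ` on the `k`-th tensor factor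
and as the identity on the others. -/
def siteOp (N : ℕ) (a : Fin 3) (k : Fin N) : Matrix (St N) (St N) ℂ :=
  Matrix.of fun x y =>
    pauli a (x k) (y k) * ∏ j ∈ Finset.univ.erase k, (if x j = y j then (1 : ℂ) else 0)

/-- The L-operator `Lₖ(λ) = λ (I ⊗ 𝟙) + (i/2) Σₐ σᵃ ⊗ σₖᵃ` on `ℂ² ⊗ 𝔥_N`. -/
def Lop (N : ℕ) (lam : ℂ) (k : Fin N) : Matrix (Fin 2 × St N) (Fin 2 × St N) ℂ :=
  lam • (1 : Matrix (Fin 2 × St N) (Fin 2 × St N) ℂ) +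
    (Complex.I / 2) • ∑ a : Fin 3,
      Matrix.of fun p q : Fin 2 × St N => pauli a p.1 q.1 * siteOp N a k p.2 q.2

/-- The monodromy matrix `T_N(λ) = L_N(λ) L_{N-1}(λ) ⋯ L_1(λ)`. -/
def monodromy (N : ℕ) (lam : ℂ) : Matrix (Fin 2 × St N) (Fin 2 × St N) ℂ :=
  (((List.finRange N).reverse).map (Lop N lam)).prod

/-- `A_N(λ)`: the (0,0) block of `T_N(λ)` in the auxiliary space. -/
def Aop (N : ℕ) (lam : ℂ) : Matrix (St N) (St N) ℂ :=
  Matrix.of fun x y => monodromy N lam (0, x) (0, y)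

/-- `B_N(λ)`: the (0,1) block of `T_N(λ)` in the auxiliary space. -/
def Bop (N : ℕ) (lam : ℂ) : Matrix (St N) (St N) ℂ :=
  Matrix.of fun x y => monodromy N lam (0, x) (1, y)

/-- `C_N(λ)`: the (1,0) block of `T_N(λ)` in the auxiliary space. -/
def Cop (N : ℕ) (lam : ℂ) : Matrix (St N) (St N) ℂ :=
  Matrix.of fun x y => monodromy N lam (1, x) (0, y)

/-- `D_N(λ)`: the (1,1) block of `T_N(λ)` in the auxiliary space. -/
def Dop (N : ℕ) (lam : ℂ) : Matrix (St N) (St N) ℂ :=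
  Matrix.of fun x y => monodromy N lam (1, x) (1, y)

/-- The transfer matrix `τ_N(λ) = A_N(λ) + D_N(λ)`. -/
def tau (N : ℕ) (lam : ℂ) : Matrix (St N) (St N) ℂ := Aop N lam + Dop N lam

/-- The vacuum vector `|0⟩_N = v₊^{⊗N}`. -/
def vac (N : ℕ) : St N → ℂ := fun x => if x = (fun _ => (0 : Fin 2)) then 1 else 0

/-- Cyclic successor on `Fin N`, implementing periodic boundary conditions. -/
def cyc {N : ℕ} (k : Fin N) : Fin N := ⟨(k.1 + 1) % N, Nat.mod_lt _ k.pos⟩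

/-- The XXX Hamiltonian
`ℋ_N = (J/4) Σₖ (σₖ¹σ_{k+1}¹ + σₖ²σ_{k+1}² + σₖ³σ_{k+1}³ − 𝟙)`. -/
def Ham (N : ℕ) (J : ℝ) : Matrix (St N) (St N) ℂ :=
  ((J : ℂ) / 4) • ∑ k : Fin N,
    ((∑ a : Fin 3, siteOp N a k * siteOp N a (cyc k)) - 1)

/-- The product of creation operators `B_N(λ₁) ⋯ B_N(λ_ℓ)`. -/
def betheProd (N : ℕ) {l : ℕ} (lam : Fin l → ℂ) : Matrix (St N) (St N) ℂ :=
  ((List.finRange l).map fun j => Bop N (lam j)).prod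

/-- The Bethe vector `B_N(λ₁) ⋯ B_N(λ_ℓ) |0⟩_N`. -/
def betheVec (N : ℕ) {l : ℕ} (lam : Fin l → ℂ) : St N → ℂ :=
  (betheProd N lam).mulVec (vac N)

/-- The eigenvalue `Λ(λ; λ₁,…,λ_ℓ)` of the transfer matrix. -/
def Lam (N : ℕ) {l : ℕ} (lam0 : ℂ) (lam : Fin l → ℂ) : ℂ :=
  (lam0 + Complex.I / 2) ^ N * ∏ j, (lam0 - lam j - Complex.I) / (lam0 - lam j) +
    (lam0 - Complex.I / 2) ^ N * ∏ j, (lam j - lam0 - Complex.I) / (lam j - lam0)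

/-- The unwanted-term coefficient `Λ_k(λ; λ₁,…,λ_ℓ)`. -/
def LamK (N : ℕ) {l : ℕ} (lam0 : ℂ) (lam : Fin l → ℂ) (k : Fin l) : ℂ :=
  Complex.I / (lam0 - lam k) *
    ((lam k + Complex.I / 2) ^ N *
        ∏ j ∈ Finset.univ.erase k, (lam k - lam j - Complex.I) / (lam k - lam j) -
      (lam k - Complex.I / 2) ^ N *
        ∏ j ∈ Finset.univ.erase k, (lam j - lam k - Complex.I) / (lam j - lam k))

/-- The Bethe ansatz equations for the spin 1/2 XXX chain of length `N`. -/
def BetheEq (N : ℕ) {l : ℕ} (lam : Fin l → ℂ) : Prop :=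
  ∀ k, ((lam k + Complex.I / 2) / (lam k - Complex.I / 2)) ^ N =
    ∏ j ∈ Finset.univ.erase k, (lam k - lam j + Complex.I) / (lam k - lam j - Complex.I)

/-- Nepomechie–Wang regularization: `λ₁(ε) = i/2 + ε + c ε^N`. -/
def nwLam1 (N : ℕ) (c : ℂ) (eps : ℂ) : ℂ := Complex.I / 2 + eps + c * eps ^ N

/-- Nepomechie–Wang regularization: `λ₂(ε) = −i/2 + ε`. -/
def nwLam2 (eps : ℂ) : ℂ := -(Complex.I / 2) + eps

/-- The regularized tuple `(λ₁(ε), λ₂(ε), λ₃, …, λ_ℓ)`. -/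
def nwTuple (N : ℕ) (c : ℂ) {m : ℕ} (mu : Fin m → ℂ) (eps : ℂ) : Fin (m + 2) → ℂ :=
  Fin.cons (nwLam1 N c eps) (Fin.cons (nwLam2 eps) mu)

/-- The singular tuple `(i/2, −i/2, λ₃, …, λ_ℓ)`. -/
def singTuple {m : ℕ} (mu : Fin m → ℂ) : Fin (m + 2) → ℂ :=
  Fin.cons (Complex.I / 2) (Fin.cons (-(Complex.I / 2)) mu)

/-- The operator on `𝔥_N` acting as `M` on the `k`-th tensor factor. -/
def localOp {N : ℕ} (k : Fin N) (M : Matrix (Fin 2) (Fin 2) ℂ) : Matrix (St N) (St N) ℂ :=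
  Matrix.of fun x y =>
    M (x k) (y k) * ∏ j ∈ Finset.univ.erase k, (if x j = y j then (1 : ℂ) else 0)

lemma localOp_apply_eq_sum {N : ℕ} (k : Fin N) (M : Matrix (Fin 2) (Fin 2) ℂ) (x y : St N) :
    localOp k M x y = ∑ t, if Function.update x k t = y then M (x k) t else 0 := by
  have h (t : Fin 2) : Function.update x k t = y ↔ t = y k ∧ ∀ j ≠ k, x j = y j := by
    rw [Function.update_eq_iff]
  simp only [localOp, Matrix.of_apply, h, Finset.prod_ite_zero, Finset.prod_const_one,
    Finset.mem_erase, Finset.mem_univ, and_true]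
  by_cases hxy : ∀ j ≠ k, x j = y j
  · have hxy' : ∀ j, j ≠ k → x j = y j := hxy
    simp +contextual [hxy']
  · simp [hxy]

lemma localOp_mul_apply {N : ℕ} (k : Fin N) (M : Matrix (Fin 2) (Fin 2) ℂ)
    (A : Matrix (St N) (St N) ℂ) (x z : St N) :
    (localOp k M * A) x z = ∑ t, M (x k) t * A (Function.update x k t) z := by
  simp only [Matrix.mul_apply, localOp_apply_eq_sum, Finset.sum_mul, ite_mul, zero_mul]
  rw [Finset.sum_comm]
  simp

lemma localOp_mul {N : ℕ} (k : Fin N) (M M' : Matrix (Fin 2) (Fin 2) ℂ) :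
    localOp k (M * M') = localOp k M * localOp k M' := by
  rw [← mul_one (localOp k (M * M')), ← mul_one (localOp k M * localOp k M'), mul_assoc]
  ext x z
  simp only [localOp_mul_apply, Matrix.mul_apply (M := M), Finset.sum_mul, Finset.mul_sum,
    Function.update_self, mul_assoc]
  rw [Finset.sum_comm]
  refine Finset.sum_congr rfl fun s _ => Finset.sum_congr rfl fun t _ => ?_
  rw [Function.update_idem]

lemma localOp_commute {N : ℕ} {k j : Fin N} (h : k ≠ j) (M M' : Matrix (Fin 2) (Fin 2) ℂ) :
    Commute (localOp k M) (localOp j M') := by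
  rw [commute_iff_eq, ← mul_one (localOp k M * localOp j M'),
    ← mul_one (localOp j M' * localOp k M), mul_assoc, mul_assoc]
  ext x z
  simp only [localOp_mul_apply, Finset.mul_sum, Function.update_of_ne h,
    Function.update_of_ne h.symm]
  rw [Finset.sum_comm]
  refine Finset.sum_congr rfl fun s _ => Finset.sum_congr rfl fun t _ => ?_
  rw [Function.update_comm h]
  ring

lemma localOp_one {N : ℕ} (k : Fin N) : localOp k 1 = 1 := by
  ext x z
  rw [localOp_apply_eq_sum, Finset.sum_eq_single (x k)]
  · simp [Matrix.one_apply]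
  · intro t _ ht
    simp [Matrix.one_apply_ne' ht]
  · simp

lemma localOp_add {N : ℕ} (k : Fin N) (M M' : Matrix (Fin 2) (Fin 2) ℂ) :
    localOp k (M + M') = localOp k M + localOp k M' := by
  ext x y
  simp [localOp, add_mul]

lemma localOp_smul {N : ℕ} (k : Fin N) (c : ℂ) (M : Matrix (Fin 2) (Fin 2) ℂ) :
    localOp k (c • M) = c • localOp k M := by
  ext x y
  simp [localOp, mul_assoc]

/-- The `RTT` relation with the rational `R`-matrix `R(u) = u + i P`, written in components. -/
def RTT {R : Type*} [Ring R] [Algebra ℂ R] (u v : ℂ) (X Y : Matrix (Fin 2) (Fin 2) R) : Prop :=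
  ∀ a b c d, (u - v) • (X a b * Y c d) + Complex.I • (X c b * Y a d) =
    (u - v) • (Y c d * X a b) + Complex.I • (Y c b * X a d)

lemma RTT.one {R : Type*} [Ring R] [Algebra ℂ R] (u v : ℂ) :
    RTT u v (1 : Matrix (Fin 2) (Fin 2) R) 1 := by
  intro a b c d
  simp only [Matrix.one_apply]
  split_ifs <;> simp

lemma RTT.mul {R : Type*} [Ring R] [Algebra ℂ R] {u v : ℂ}
    {X Y X' Y' : Matrix (Fin 2) (Fin 2) R} (h : RTT u v X Y) (h' : RTT u v X' Y')
    (hXY : ∀ a b c d, Commute (X a b) (Y' c d)) (hYX : ∀ a b c d, Commute (Y a b) (X' c d)) :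
    RTT u v (X * X') (Y * Y') := by
  have hl (a b c d : Fin 2) : (X * X') a b * (Y * Y') c d =
      ∑ e, ∑ f, X a e * Y c f * (X' e b * Y' f d) := by
    simp only [Matrix.mul_apply, Finset.sum_mul_sum]
    refine Finset.sum_congr rfl fun e _ => Finset.sum_congr rfl fun f _ => ?_
    rw [mul_assoc, ← mul_assoc (X' e b), ← (hYX c f e b).eq]
    simp only [mul_assoc]
  have hr (a b c d : Fin 2) : (Y * Y') c d * (X * X') a b =
      ∑ e, ∑ f, Y c f * X a e * (Y' f d * X' e b) := by
    simp only [Matrix.mul_apply, Finset.sum_mul_sum]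
    rw [Finset.sum_comm]
    refine Finset.sum_congr rfl fun e _ => Finset.sum_congr rfl fun f _ => ?_
    rw [mul_assoc, ← mul_assoc (Y' f d), ← (hXY a e f d).eq]
    simp only [mul_assoc]
  intro a b c d
  calc (u - v) • ((X * X') a b * (Y * Y') c d) + Complex.I • ((X * X') c b * (Y * Y') a d)
      = ∑ e, ∑ f, ((u - v) • (X a e * Y c f) + Complex.I • (X c e * Y a f)) *
          (X' e b * Y' f d) := by
        simp only [hl, Finset.smul_sum, ← Finset.sum_add_distrib, add_mul, smul_mul_assoc]
    _ = (∑ e, ∑ f, (u - v) • (Y c f * X a e * (X' e b * Y' f d))) +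
          ∑ f, ∑ e, Complex.I • (Y c f * X a e * (X' f b * Y' e d)) := by
        simp only [h a _ c _, add_mul, smul_mul_assoc, Finset.sum_add_distrib]
    _ = ∑ e, ∑ f, Y c f * X a e *
          ((u - v) • (X' e b * Y' f d) + Complex.I • (X' f b * Y' e d)) := by
        rw [Finset.sum_comm (f := fun f e => Complex.I • (Y c f * X a e * (X' f b * Y' e d)))]
        simp only [mul_add, mul_smul_comm, Finset.sum_add_distrib]
    _ = _ := by
        simp only [h' _ b _ d, hr, mul_add, mul_smul_comm, Finset.sum_add_distrib,
          Finset.smul_sum]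

/-- The blocks, in the auxiliary space, of an operator on `ℂ² ⊗ 𝔥_N`. -/
def auxBlocks (N : ℕ) :
    Matrix (Fin 2 × St N) (Fin 2 × St N) ℂ ≃+* Matrix (Fin 2) (Fin 2) (Matrix (St N) (St N) ℂ) :=
  (Matrix.compRingEquiv (Fin 2) (St N) ℂ).symm

/-- The entry `(a, b)` of the one-site `L`-operator in the auxiliary space. -/
def localL (lam : ℂ) (a b : Fin 2) : Matrix (Fin 2) (Fin 2) ℂ :=
  (lam * (1 : Matrix (Fin 2) (Fin 2) ℂ) a b) • 1 +
    (Complex.I / 2) • (pauli 0 a b • pauli 0 + pauli 1 a b • pauli 1 + pauli 2 a b • pauli 2)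

lemma auxBlocks_Lop {N : ℕ} (lam : ℂ) (k : Fin N) (a b : Fin 2) :
    auxBlocks N (Lop N lam k) a b = localOp k (localL lam a b) := by
  have hp (i : Fin 3) : siteOp N i k = localOp k (pauli i) := rfl
  simp only [localL, localOp_add, localOp_smul, localOp_one, ← hp]
  ext x y
  have h1 : (1 : Matrix (Fin 2 × St N) (Fin 2 × St N) ℂ) (a, x) (b, y) =
      (1 : Matrix (Fin 2) (Fin 2) ℂ) a b * (1 : Matrix (St N) (St N) ℂ) x y := by
    by_cases a = b <;> simp [Matrix.one_apply, *]
  change Lop N lam k (a, x) (b, y) = _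
  simp [Lop, Fin.sum_univ_three, h1, mul_assoc]

lemma localL_apply (lam : ℂ) (a b i j : Fin 2) :
    localL lam a b i j = (if a = b ∧ i = j then lam - Complex.I / 2 else 0) +
      if a = j ∧ b = i then Complex.I else 0 := by
  simp only [localL, Matrix.add_apply, Matrix.smul_apply, smul_eq_mul]
  fin_cases a <;> fin_cases b <;> fin_cases i <;> fin_cases j <;>
    simp [pauli] <;> grind [Complex.I_mul_I]

lemma RTT_localL (u v : ℂ) (a b c d : Fin 2) :
    (u - v) • (localL u a b * localL v c d) + Complex.I • (localL u c b * localL v a d) =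
      (u - v) • (localL v c d * localL u a b) + Complex.I • (localL v c b * localL u a d) := by
  ext i j
  fin_cases a <;> fin_cases b <;> fin_cases c <;> fin_cases d <;> fin_cases i <;> fin_cases j <;>
    simp [localL_apply, Matrix.mul_apply] <;> grind [Complex.I_mul_I]

lemma RTT_Lop {N : ℕ} (u v : ℂ) (k : Fin N) :
    RTT u v (auxBlocks N (Lop N u k)) (auxBlocks N (Lop N v k)) := by
  intro a b c d
  simp only [auxBlocks_Lop, ← localOp_mul, ← localOp_smul, ← localOp_add, RTT_localL u v a b c d]

lemma commute_auxBlocks_prod {N : ℕ} (v : ℂ) {k : Fin N} (M : Matrix (Fin 2) (Fin 2) ℂ)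
    {l : List (Fin N)} (hk : k ∉ l) (c d : Fin 2) :
    Commute (localOp k M) (auxBlocks N (l.map (Lop N v)).prod c d) := by
  induction l generalizing c d with
  | nil =>
    simp only [List.map_nil, List.prod_nil, map_one, Matrix.one_apply]
    split_ifs <;> simp
  | cons j l ih =>
    simp only [List.mem_cons, not_or] at hk
    simp only [List.map_cons, List.prod_cons, map_mul, Matrix.mul_apply, auxBlocks_Lop]
    exact Commute.sum_right _ _ _ fun e _ =>
      (localOp_commute hk.1 _ _).mul_right (ih hk.2 e d)

lemma RTT_prod {N : ℕ} (u v : ℂ) {l : List (Fin N)} (hl : l.Nodup) :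
    RTT u v (auxBlocks N (l.map (Lop N u)).prod) (auxBlocks N (l.map (Lop N v)).prod) := by
  induction l with
  | nil => simpa using RTT.one u v
  | cons k l ih =>
    rw [List.nodup_cons] at hl
    simp only [List.map_cons, List.prod_cons, map_mul]
    refine (RTT_Lop u v k).mul (ih hl.2) (fun a b c d => ?_) fun a b c d => ?_ <;>
    · rw [auxBlocks_Lop]
      exact commute_auxBlocks_prod _ _ hl.1 c d

lemma RTT_monodromy (N : ℕ) (u v : ℂ) :
    RTT u v (auxBlocks N (monodromy N u)) (auxBlocks N (monodromy N v)) :=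
  RTT_prod u v (List.nodup_reverse.mpr (List.nodup_finRange N))

/-- The creation operators commute: `B_N(λ) B_N(μ) = B_N(μ) B_N(λ)`. -/
theorem creation_operators_commute (N : ℕ) (hN : 1 ≤ N) (lam mu : ℂ) :
    Bop N lam * Bop N mu = Bop N mu * Bop N lam := by
  have hB (u : ℂ) : auxBlocks N (monodromy N u) 0 1 = Bop N u := rfl
  have h₁ := RTT_monodromy N lam mu 0 1 0 1
  have h₂ := RTT_monodromy N mu lam 0 1 0 1
  simp only [hB] at h₁ h₂
  have h : (2 * Complex.I) • (Bop N lam * Bop N mu) =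
      (2 * Complex.I) • (Bop N mu * Bop N lam) := by
    linear_combination (norm := module) h₁ - h₂
  exact smul_right_injective _ (mul_ne_zero two_ne_zero Complex.I_ne_zero) h
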